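/- Let λ > 1 be irrational and let g ∈ G_λ with g ≠ id. Then there exist an open interval J whose closure is contained in (0,1) and an element f ≠ id of the normal closure of g in G_λ such that Supp(f) ⊆ ⋃_{n ∈ ℤ} (n + J). -/

import Mathlib

open Set

noncomputable section

/-- The dyadic rationals `ℤ[1/2]` inside `ℝ`. -/
def DyadicRat : Set ℝ := {x : ℝ | ∃ (a : ℤ) (k : ℕ), x = a / 2 ^ k}

/-- A function `g : ℝ → ℝ` satisfies the defining conditions of (the underlying map of)
an element of `T̄`: it commutes with the translation `x ↦ x + 1`, and away from a
locally finite set `D ⊆ ℤ[1/2]` of allowed breakpoints it is locally affine with slope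
an integer power of `2`.  (Local finiteness of `D` on compact intervals encodes
"finitely many breakpoints in each compact interval".) -/
def TbarFun (g : ℝ → ℝ) : Prop :=
  (∀ x : ℝ, g (x + 1) = g x + 1) ∧
  ∃ D : Set ℝ, D ⊆ DyadicRat ∧ (∀ a b : ℝ, (D ∩ Set.Icc a b).Finite) ∧
    ∀ x : ℝ, x ∉ D → ∃ (m : ℤ) (c ε : ℝ), 0 < ε ∧
      ∀ y : ℝ, |y - x| < ε → g y = 2 ^ m * y + c

/-- The lift `T̄` of Thompson's group `T` to the real line, as a set of increasing
bijections of `ℝ`. -/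
def Tbar : Set (Equiv.Perm ℝ) := {g : Equiv.Perm ℝ | StrictMono ⇑g ∧ TbarFun ⇑g}

/-- `T̄_λ = m_λ⁻¹ T̄ m_λ`, where `x · m_λ = λ x`: the lift of `T` with respect to the
identification `ℝ → ℝ/λℤ`. -/
def TbarL (l : ℝ) : Set (Equiv.Perm ℝ) :=
  {g : Equiv.Perm ℝ | StrictMono ⇑g ∧ TbarFun (fun y : ℝ => g (l * y) / l)}

/-- The group `G_λ = ⟨T̄ ∪ T̄_λ⟩ ≤ Homeo⁺(ℝ)`. -/
def Glambda (l : ℝ) : Subgroup (Equiv.Perm ℝ) := Subgroup.closure (Tbar ∪ TbarL l)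

/-! ### Dents: homeomorphisms supported on `ℤ + (0, 2⁻ᵏ)` -/

/-- The piecewise linear homeomorphism of `ℝ` with slopes `1/2, 1, 2` supported on `(0, d)`. -/
def dent (d y : ℝ) : ℝ := min y (max (y / 2) (max (y - d / 4) (2 * y - d)))

/-- The inverse of `dent d`. -/
def dentInv (d y : ℝ) : ℝ := max y (min (2 * y) (min (y + d / 4) ((y + d) / 2)))

theorem dent_dentInv {d : ℝ} (hd : 0 < d) (y : ℝ) : dent d (dentInv d y) = y := by
  unfold dent dentInv; grind

theorem dentInv_dent {d : ℝ} (hd : 0 < d) (y : ℝ) : dentInv d (dent d y) = y := by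
  unfold dent dentInv; grind

theorem dent_mem_Ico {d : ℝ} {y : ℝ} (hy : y ∈ Ico (0 : ℝ) 1) : dent d y ∈ Ico (0 : ℝ) 1 := by
  obtain ⟨h0, h1⟩ := hy
  unfold dent
  constructor <;> grind

theorem dentInv_mem_Ico {d : ℝ} (hd : d ≤ 1) {y : ℝ} (hy : y ∈ Ico (0 : ℝ) 1) :
    dentInv d y ∈ Ico (0 : ℝ) 1 := by
  obtain ⟨h0, h1⟩ := hy
  unfold dentInv
  constructor <;> grind

theorem dent_strictMono (d : ℝ) : StrictMono (dent d) := by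
  intro x y h
  unfold dent
  grind

theorem dent_ne_iff {d y : ℝ} (hd : 0 < d) : dent d y ≠ y ↔ y ∈ Ioo 0 d := by
  unfold dent
  constructor
  · intro h; constructor <;> grind
  · rintro ⟨h, h'⟩; grind

theorem abs_dent_sub_le {d : ℝ} (hd : 0 < d) (y : ℝ) : |dent d y - y| ≤ d := by
  unfold dent
  rw [abs_le]
  constructor <;> grind

theorem floor_fract_add {n : ℤ} {t : ℝ} (ht : t ∈ Ico (0 : ℝ) 1) :
    ⌊(n : ℝ) + t⌋ = n ∧ Int.fract ((n : ℝ) + t) = t := by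
  have h : ⌊(n : ℝ) + t⌋ = n := by
    rw [Int.floor_eq_iff]
    exact ⟨by linarith [ht.1], by linarith [ht.2]⟩
  refine ⟨h, ?_⟩
  rw [Int.fract, h]
  ring

theorem two_pow_inv_le_one (k : ℕ) : ((2 : ℝ) ^ k)⁻¹ ≤ 1 :=
  inv_le_one_of_one_le₀ (one_le_pow₀ (by norm_num))

theorem fract_mem_Ico (x : ℝ) : Int.fract x ∈ Ico (0 : ℝ) 1 :=
  ⟨Int.fract_nonneg x, Int.fract_lt_one x⟩

/-- The `1`-periodic extension of `dent (2 ^ k)⁻¹`, supported on `ℤ + (0, 2⁻ᵏ)`. -/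
def periodicDent (k : ℕ) : Equiv.Perm ℝ where
  toFun x := ⌊x⌋ + dent (2 ^ k)⁻¹ (Int.fract x)
  invFun x := ⌊x⌋ + dentInv (2 ^ k)⁻¹ (Int.fract x)
  left_inv x := by
    obtain ⟨h, h'⟩ := floor_fract_add (n := ⌊x⌋)
      (dent_mem_Ico (d := (2 ^ k)⁻¹) (fract_mem_Ico x))
    simp only [h, h']
    rw [dentInv_dent (by positivity), Int.floor_add_fract]
  right_inv x := by
    obtain ⟨h, h'⟩ := floor_fract_add (n := ⌊x⌋)
      (dentInv_mem_Ico (two_pow_inv_le_one k) (fract_mem_Ico x))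
    simp only [h, h']
    rw [dent_dentInv (by positivity), Int.floor_add_fract]

theorem periodicDent_apply (k : ℕ) (x : ℝ) :
    periodicDent k x = ⌊x⌋ + dent (2 ^ k)⁻¹ (Int.fract x) := rfl

theorem periodicDent_sub (k : ℕ) (x : ℝ) :
    periodicDent k x - x = dent (2 ^ k)⁻¹ (Int.fract x) - Int.fract x := by
  rw [periodicDent_apply, Int.fract]
  ring

theorem periodicDent_ne_iff (k : ℕ) (x : ℝ) :
    periodicDent k x ≠ x ↔ Int.fract x ∈ Ioo 0 ((2 : ℝ) ^ k)⁻¹ := by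
  rw [← dent_ne_iff (by positivity), ← sub_ne_zero, periodicDent_sub, sub_ne_zero]

theorem abs_periodicDent_sub_le (k : ℕ) (x : ℝ) : |periodicDent k x - x| ≤ ((2 : ℝ) ^ k)⁻¹ := by
  rw [periodicDent_sub]
  exact abs_dent_sub_le (by positivity) _

theorem periodicDent_strictMono (k : ℕ) : StrictMono (periodicDent k) := by
  intro x y h
  simp only [periodicDent_apply]
  rcases (Int.floor_mono h.le).lt_or_eq with hf | hf
  · have hf' : (⌊x⌋ : ℝ) + 1 ≤ ⌊y⌋ := by exact_mod_cast hf
    linarith [(dent_mem_Ico (d := (2 ^ k)⁻¹) (fract_mem_Ico x)).2,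
      (dent_mem_Ico (d := (2 ^ k)⁻¹) (fract_mem_Ico y)).1]
  · rw [hf]
    gcongr
    apply dent_strictMono
    rw [Int.fract, Int.fract, hf]
    linarith

theorem locallyFinite_int_div {N : ℝ} (hN : 0 < N) (a b : ℝ) :
    ({x : ℝ | ∃ n : ℤ, x = n / N} ∩ Icc a b).Finite := by
  refine ((finite_Icc ⌊a * N⌋ ⌈b * N⌉).image fun n : ℤ => (n : ℝ) / N).subset ?_
  rintro _ ⟨⟨n, rfl⟩, h1, h2⟩
  rw [le_div_iff₀ hN] at h1
  rw [div_le_iff₀ hN] at h2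
  refine ⟨n, ⟨?_, ?_⟩, rfl⟩
  · exact_mod_cast (Int.floor_le _).trans h1
  · exact_mod_cast h2.trans (Int.le_ceil _)

theorem periodicDent_tbarFun (k : ℕ) : TbarFun (periodicDent k) := by
  refine ⟨fun x => ?_, {x | ∃ n : ℤ, x = n / 2 ^ (k + 2)}, ?_,
    locallyFinite_int_div (by positivity), ?_⟩
  · simp only [periodicDent_apply, Int.floor_add_one, Int.fract_add_one]
    push_cast
    ring
  · rintro _ ⟨n, rfl⟩
    exact ⟨n, k + 2, rfl⟩
  intro x hx
  set N : ℝ := 2 ^ (k + 2) with hN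
  have hN0 : 0 < N := by positivity
  have hd : ((2 : ℝ) ^ k)⁻¹ = 4 / N := by
    rw [hN, pow_add]
    field_simp
    norm_num
  obtain ⟨m, hm⟩ : ∃ m : ℤ, m = ⌊x * N⌋ := ⟨_, rfl⟩
  have hm1 : (m : ℝ) < x * N := by
    refine lt_of_le_of_ne (hm ▸ Int.floor_le _) fun h => hx ⟨m, ?_⟩
    rw [h]
    field_simp
  have hm2 : x * N < m + 1 := hm ▸ Int.lt_floor_add_one _
  -- write `m = N * q + j` with `0 ≤ j < N`
  obtain ⟨q, j, hj0, hjN, hmqj⟩ :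
      ∃ q j : ℤ, 0 ≤ j ∧ (j : ℝ) + 1 ≤ N ∧ (m : ℝ) = N * q + j := by
    refine ⟨m / 2 ^ (k + 2), m % 2 ^ (k + 2), Int.emod_nonneg _ (by positivity), ?_, ?_⟩
    · have := Int.emod_lt_of_pos m (b := 2 ^ (k + 2)) (by positivity)
      rw [hN]
      exact_mod_cast this
    · rw [hN]
      exact_mod_cast (Int.mul_ediv_add_emod m (2 ^ (k + 2))).symm
  have hfl : ∀ y : ℝ, |y - x| < min (x - m / N) ((m + 1) / N - x) →
      periodicDent k y = q + dent (4 / N) (y - q) ∧ j < N * (y - q) ∧ N * (y - q) < j + 1 := by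
    intro y hy
    have hy1 := abs_lt.1 (hy.trans_le (min_le_left _ _))
    have hy2 := abs_lt.1 (hy.trans_le (min_le_right _ _))
    have h1 : m < y * N := by
      rw [← div_lt_iff₀ hN0]; linarith [hy1.1]
    have h2 : y * N < m + 1 := by
      rw [← lt_div_iff₀ hN0]; linarith [hy2.2]
    have hj1 : (j : ℝ) < N * (y - q) := by linarith
    have hj2 : N * (y - q) < j + 1 := by linarith
    have hj0' : (0 : ℝ) ≤ j := by exact_mod_cast hj0
    have h3 : y - q ∈ Ico (0 : ℝ) 1 := by
      constructor
      · exact (pos_of_mul_pos_right (hj0'.trans_lt hj1) hN0.le).le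
      · by_contra! h
        nlinarith
    obtain ⟨h4, h5⟩ := floor_fract_add (n := q) h3
    rw [add_sub_cancel] at h4 h5
    rw [periodicDent_apply, h4, h5, hd]
    exact ⟨rfl, hj1, hj2⟩
  have hε : 0 < min (x - m / N) ((m + 1) / N - x) := by
    refine lt_min ?_ ?_
    · rw [sub_pos, div_lt_iff₀ hN0]; exact hm1
    · rw [sub_pos, lt_div_iff₀ hN0]; exact hm2
  have hu : ∀ y : ℝ, y = (N * y) * (1 / N) := fun y => by field_simp
  have hi : 0 < 1 / N := by positivity
  have key : ∀ y : ℝ, dent (4 / N) y =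
      min (N * y) (max (N * y / 2) (max (N * y - 1) (2 * (N * y) - 4))) * (1 / N) := by
    intro y
    rw [min_mul_of_nonneg _ _ hi.le, max_mul_of_nonneg _ _ hi.le, max_mul_of_nonneg _ _ hi.le, dent]
    congr 1
    · field_simp
    congr 1
    · field_simp
    congr 1
    · field_simp
    · field_simp
  obtain h | h | h | h : j ≤ 1 ∨ j = 2 ∨ j = 3 ∨ 4 ≤ j := by omega
  · refine ⟨-1, q - q / 2, _, hε, fun y hy => ?_⟩
    obtain ⟨e, h1, h2⟩ := hfl y hy
    have hj0' : (0 : ℝ) ≤ j := by exact_mod_cast hj0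
    have h' : (j : ℝ) ≤ 1 := by exact_mod_cast h
    have : min (N * (y - q)) (max (N * (y - q) / 2) (max (N * (y - q) - 1) (2 * (N * (y - q)) - 4)))
        = N * (y - q) / 2 := by grind
    rw [e, key, this]
    norm_num
    field_simp
    ring
  · refine ⟨0, - 1 / N, _, hε, fun y hy => ?_⟩
    obtain ⟨e, h1, h2⟩ := hfl y hy
    subst h
    push_cast at h1 h2
    have : min (N * (y - q)) (max (N * (y - q) / 2) (max (N * (y - q) - 1) (2 * (N * (y - q)) - 4)))
        = N * (y - q) - 1 := by grind
    rw [e, key, this]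
    norm_num
    field_simp
    ring
  · refine ⟨1, - q - 4 / N, _, hε, fun y hy => ?_⟩
    obtain ⟨e, h1, h2⟩ := hfl y hy
    subst h
    push_cast at h1 h2
    have : min (N * (y - q)) (max (N * (y - q) / 2) (max (N * (y - q) - 1) (2 * (N * (y - q)) - 4)))
        = 2 * (N * (y - q)) - 4 := by grind
    rw [e, key, this]
    norm_num
    field_simp
    ring
  · refine ⟨0, 0, _, hε, fun y hy => ?_⟩
    obtain ⟨e, h1, h2⟩ := hfl y hy
    have h' : (4 : ℝ) ≤ j := by exact_mod_cast h
    have : min (N * (y - q)) (max (N * (y - q) / 2) (max (N * (y - q) - 1) (2 * (N * (y - q)) - 4)))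
        = N * (y - q) := by grind
    rw [e, key, this]
    norm_num
    field_simp
    ring

/-! ### Bumps: translated and rescaled dents -/

/-- The homeomorphism `periodicDent k` transported by `y ↦ s * y`. -/
def scaledDent (s : ℝ) (hs : 0 < s) (k : ℕ) : Equiv.Perm ℝ :=
  (Equiv.mulLeft₀ s hs.ne').permCongr (periodicDent k)

theorem scaledDent_apply (s : ℝ) (hs : 0 < s) (k : ℕ) (y : ℝ) :
    scaledDent s hs k y = s * periodicDent k (y / s) := by
  simp [scaledDent, div_eq_inv_mul]

/-- The homeomorphism `periodicDent k` transported by `y ↦ s * y + c`. -/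
def bump (s : ℝ) (hs : 0 < s) (c : ℝ) (k : ℕ) : Equiv.Perm ℝ :=
  Equiv.addRight c * scaledDent s hs k * (Equiv.addRight c)⁻¹

theorem bump_apply (s : ℝ) (hs : 0 < s) (c : ℝ) (k : ℕ) (y : ℝ) :
    bump s hs c k y = s * periodicDent k ((y - c) / s) + c := by
  simp [bump, scaledDent_apply, Equiv.Perm.mul_apply, sub_eq_add_neg]

theorem bump_sub (s : ℝ) (hs : 0 < s) (c : ℝ) (k : ℕ) (y : ℝ) :
    bump s hs c k y - y = s * (periodicDent k ((y - c) / s) - (y - c) / s) := by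
  rw [bump_apply]
  field_simp
  ring

theorem bump_ne_iff (s : ℝ) (hs : 0 < s) (c : ℝ) (k : ℕ) (y : ℝ) :
    bump s hs c k y ≠ y ↔ Int.fract ((y - c) / s) ∈ Ioo 0 ((2 : ℝ) ^ k)⁻¹ := by
  rw [← periodicDent_ne_iff, ← sub_ne_zero, bump_sub, mul_ne_zero_iff, sub_ne_zero]
  exact and_iff_right hs.ne'

theorem abs_bump_sub_le (s : ℝ) (hs : 0 < s) (c : ℝ) (k : ℕ) (y : ℝ) :
    |bump s hs c k y - y| ≤ s * ((2 : ℝ) ^ k)⁻¹ := by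
  rw [bump_sub, abs_mul, abs_of_pos hs]
  gcongr
  exact abs_periodicDent_sub_le _ _

theorem addRight_mem_TbarL {s : ℝ} (hs : 0 < s) (c : ℝ) : Equiv.addRight c ∈ TbarL s := by
  refine ⟨fun x y h => by simpa using h, fun x => ?_, ∅, by simp, by simp, fun x _ =>
    ⟨0, c / s, 1, one_pos, fun y _ => ?_⟩⟩
  · simp
    field_simp
    ring
  · simp
    field_simp

theorem scaledDent_mem_TbarL (s : ℝ) (hs : 0 < s) (k : ℕ) : scaledDent s hs k ∈ TbarL s := by
  constructor
  · intro x y h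
    simp only [scaledDent_apply]
    gcongr
    apply periodicDent_strictMono
    gcongr
  · convert periodicDent_tbarFun k using 1
    ext y
    rw [scaledDent_apply, mul_div_cancel_left₀ _ hs.ne', mul_div_cancel_left₀ _ hs.ne']

theorem Tbar_eq_TbarL_one : Tbar = TbarL 1 := by
  simp [Tbar, TbarL]

theorem TbarL_subset_Glambda {l s : ℝ} (h : s = 1 ∨ s = l) : TbarL s ⊆ Glambda l := by
  refine Subset.trans ?_ Subgroup.subset_closure
  rcases h with rfl | rfl
  · rw [← Tbar_eq_TbarL_one]
    exact subset_union_left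
  · exact subset_union_right

theorem bump_mem_Glambda {l s : ℝ} (hs : 0 < s) (h : s = 1 ∨ s = l) (c : ℝ) (k : ℕ) :
    bump s hs c k ∈ Glambda l := by
  have ht := TbarL_subset_Glambda h (addRight_mem_TbarL hs c)
  exact mul_mem (mul_mem ht (TbarL_subset_Glambda h (scaledDent_mem_TbarL s hs k))) (inv_mem ht)

/-- A permutation commuting with all sufficiently fine bumps of period `s` moves every point by
an integer multiple of `s`. -/
theorem exists_int_of_commute_bump {s : ℝ} (hs : 0 < s) (K : ℕ) {g : Equiv.Perm ℝ}
    (hg : ∀ k ≥ K, ∀ c, Commute g (bump s hs c k)) (x : ℝ) : ∃ n : ℤ, g x - x = n * s := by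
  suffices h : ∀ k ≥ K, |(g x - x) / s - round ((g x - x) / s)| ≤ (1 / 2 : ℝ) ^ k by
    refine ⟨round ((g x - x) / s), ?_⟩
    have h0 : |(g x - x) / s - round ((g x - x) / s)| ≤ 0 :=
      ge_of_tendsto (tendsto_pow_atTop_nhds_zero_of_lt_one (by norm_num) (by norm_num))
        (Filter.eventually_atTop.2 ⟨K, h⟩)
    rw [← div_eq_iff hs.ne']
    exact sub_eq_zero.1 (abs_nonpos_iff.1 h0)
  intro k hk
  set d : ℝ := ((2 : ℝ) ^ k)⁻¹ with hd
  have hd0 : 0 < d := by positivity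
  have hd1 : d ≤ 1 := two_pow_inv_le_one k
  set c : ℝ := x - s * (d / 2) with hc
  have hx : bump s hs c k x ≠ x := by
    rw [bump_ne_iff]
    have : (x - c) / s = d / 2 := by
      rw [hc]
      field_simp
      ring
    rw [this, Int.fract_eq_self.2 ⟨by linarith, by linarith⟩]
    exact ⟨by linarith, by linarith⟩
  have hgx : bump s hs c k (g x) ≠ g x := by
    intro h
    rw [← Equiv.Perm.mul_apply, ← (hg k hk c).eq, Equiv.Perm.mul_apply] at h
    exact hx (g.injective h)
  obtain ⟨h1, h2⟩ := (bump_ne_iff s hs c k (g x)).1 hgx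
  have e : (g x - c) / s = (g x - x) / s + d / 2 := by
    rw [hc]
    field_simp
    ring
  rw [e, Int.fract] at h1 h2
  refine (round_le _ ⌊(g x - x) / s + d / 2⌋).trans ?_
  rw [one_div, inv_pow, ← hd, abs_le]
  constructor <;> linarith

/-! ### Uniform continuity -/

theorem uniformContinuous_of_add_eq {g : Equiv.Perm ℝ} (hg : StrictMono g) {s : ℝ} (hs : 0 < s)
    (hp : ∀ x, g (x + s) = g x + s) : UniformContinuous g := by
  have hc : Continuous g := hg.monotone.continuous_of_surjective g.surjective
  have hper : Function.Periodic (fun x => g x - x) s := fun x => by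
    simp only [hp]
    ring
  have : UniformContinuous fun x => g x - x := by
    have : Fact (0 < s) := ⟨hs⟩
    have hlift : Continuous hper.lift := (hc.sub continuous_id).quotient_lift _
    exact (CompactSpace.uniformContinuous_of_continuous hlift).comp
      (uniformContinuous_addMonoidHom_of_continuous (f := QuotientAddGroup.mk' _)
        (AddCircle.continuous_mk' s))
  simpa using this.add uniformContinuous_id

theorem uniformContinuous_of_mem_TbarL {s : ℝ} (hs : 0 < s) {g : Equiv.Perm ℝ} (hg : g ∈ TbarL s) :
    UniformContinuous g ∧ UniformContinuous ⇑(g⁻¹) := by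
  obtain ⟨hm, hp, -⟩ := hg
  have hp' : ∀ x, g (x + s) = g x + s := by
    intro x
    have := hp (x / s)
    field_simp at this
    exact this
  refine ⟨uniformContinuous_of_add_eq hm hs hp', uniformContinuous_of_add_eq ?_ hs fun x => ?_⟩
  · intro x y h
    rw [← hm.lt_iff_lt]
    simpa using h
  · apply g.injective
    rw [hp']
    simp

theorem uniformContinuous_of_mem_Glambda {l : ℝ} (hl : 0 < l) {g : Equiv.Perm ℝ}
    (hg : g ∈ Glambda l) : UniformContinuous g := by
  suffices h : UniformContinuous g ∧ UniformContinuous ⇑(g⁻¹) from h.1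
  induction hg using Subgroup.closure_induction with
  | mem x hx =>
    rcases hx with hx | hx
    · exact uniformContinuous_of_mem_TbarL one_pos (Tbar_eq_TbarL_one ▸ hx)
    · exact uniformContinuous_of_mem_TbarL hl hx
  | one => exact ⟨uniformContinuous_id, uniformContinuous_id⟩
  | mul x y _ _ hx hy =>
    rw [mul_inv_rev]
    exact ⟨hx.1.comp hy.1, hy.2.comp hx.2⟩
  | inv x _ hx => exact ⟨hx.2, by simpa using hx.1⟩

/-! ### Commutators -/

open scoped commutatorElement

theorem abs_sub_inv_apply_le {b : Equiv.Perm ℝ} {δ : ℝ} (h : ∀ x, |b x - x| ≤ δ) (x : ℝ) :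
    |b⁻¹ x - x| ≤ δ := by
  have := h (b⁻¹ x)
  rwa [show b (b⁻¹ x) = x from b.apply_symm_apply x, abs_sub_comm] at this

/-- Commutators of a uniformly continuous permutation with permutations close to the identity
are close to the identity. -/
theorem exists_abs_commutator_sub_le {g : Equiv.Perm ℝ} (hg : UniformContinuous g) {ε : ℝ}
    (hε : 0 < ε) : ∃ δ > 0, ∀ b : Equiv.Perm ℝ, (∀ x, |b x - x| ≤ δ) →
      ∀ x, |⁅g, b⁆ x - x| ≤ ε := by
  obtain ⟨δ, hδ, h⟩ := Metric.uniformContinuous_iff.1 hg (ε / 2) (by positivity)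
  refine ⟨min (δ / 2) (ε / 2), by positivity, fun b hb x => ?_⟩
  have h1 := hb (g⁻¹ (b⁻¹ x))
  have h2 := abs_sub_inv_apply_le hb x
  have h3 : |g (b (g⁻¹ (b⁻¹ x))) - g (g⁻¹ (b⁻¹ x))| < ε / 2 :=
    h (by rw [Real.dist_eq]; linarith [min_le_left (δ / 2) (ε / 2)])
  rw [show g (g⁻¹ (b⁻¹ x)) = b⁻¹ x from g.apply_symm_apply _] at h3
  have h4 := min_le_right (δ / 2) (ε / 2)
  simp only [commutatorElement_def, Equiv.Perm.mul_apply]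
  rw [abs_le] at *
  rw [abs_lt] at h3
  constructor <;> linarith

/-- If the commutator `⁅f, b⁆` moves `x`, then `b` moves `x` or `f⁻¹ x`. -/
theorem ne_or_ne_of_commutator_ne {f b : Equiv.Perm ℝ} {x : ℝ} (h : ⁅f, b⁆ x ≠ x) :
    b x ≠ x ∨ b (f⁻¹ x) ≠ f⁻¹ x := by
  by_contra! hc
  obtain ⟨h1, h2⟩ := hc
  apply h
  have h3 : b⁻¹ x = x := b.injective ((b.apply_symm_apply x).trans h1.symm)
  simp only [commutatorElement_def, Equiv.Perm.mul_apply]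
  rw [h3, h2]
  exact f.apply_symm_apply x

theorem commutator_mem_normalClosure {G : Type*} [Group G] {s : Set G} {g : G}
    (hg : g ∈ Subgroup.normalClosure s) (h : G) : ⁅g, h⁆ ∈ Subgroup.normalClosure s := by
  rw [commutatorElement_def, mul_assoc, mul_assoc, ← mul_assoc h]
  exact mul_mem hg (Subgroup.normalClosure_normal.conj_mem _ (inv_mem hg) h)

/-- A nontrivial element of `G_λ` fails to commute with some arbitrarily fine bump. -/
theorem exists_not_commute_bump {l : ℝ} (hl : 0 < l) (hirr : Irrational l) {g : Equiv.Perm ℝ}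
    (hg : g ≠ 1) (K : ℕ) : ∃ (s : ℝ) (hs : 0 < s), (s = 1 ∨ s = l) ∧
      ∃ k ≥ K, ∃ c, ¬ Commute g (bump s hs c k) := by
  by_contra! H
  apply hg
  ext x
  obtain ⟨n, hn⟩ := exists_int_of_commute_bump one_pos K (H 1 one_pos (Or.inl rfl)) x
  obtain ⟨m, hm⟩ := exists_int_of_commute_bump hl K (H l hl (Or.inr rfl)) x
  rcases eq_or_ne m 0 with rfl | hm0
  · simpa [sub_eq_zero] using hm
  · refine absurd ⟨n / m, ?_⟩ hirr
    have : (m : ℝ) ≠ 0 := by exact_mod_cast hm0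
    push_cast
    field_simp
    linarith

/-- The normal closure of a nontrivial element of `G_λ` contains nontrivial elements arbitrarily
close to the identity. -/
theorem exists_mem_normalClosure_abs_sub_le {l : ℝ} (hl : 0 < l) (hirr : Irrational l)
    {g : Glambda l} (hg : g ≠ 1) {ε : ℝ} (hε : 0 < ε) :
    ∃ f ∈ Subgroup.normalClosure ({g} : Set (Glambda l)), f ≠ 1 ∧
      ∀ x, |(f : Equiv.Perm ℝ) x - x| ≤ ε := by
  obtain ⟨δ, hδ, h⟩ := exists_abs_commutator_sub_le (uniformContinuous_of_mem_Glambda hl g.2) hε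
  obtain ⟨K, hK⟩ := exists_pow_lt_of_lt_one (show 0 < δ / (1 + l) by positivity)
    (show (1 / 2 : ℝ) < 1 by norm_num)
  obtain ⟨s, hs, hsl, k, hk, c, hc⟩ :=
    exists_not_commute_bump hl hirr (g := g) (by simpa using hg) K
  let b : Glambda l := ⟨bump s hs c k, bump_mem_Glambda hs hsl c k⟩
  have hg' := Subgroup.subset_normalClosure (mem_singleton g)
  refine ⟨⁅g, b⁆, commutator_mem_normalClosure hg' b, ?_, ?_⟩
  · rw [Ne, commutatorElement_eq_one_iff_commute]
    intro h
    exact hc (h.map (Glambda l).subtype)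
  · have hb : ((⁅g, b⁆ : Glambda l) : Equiv.Perm ℝ) = ⁅(g : Equiv.Perm ℝ), bump s hs c k⁆ :=
      map_commutatorElement (Glambda l).subtype g b
    rw [hb]
    refine h _ fun x => (abs_bump_sub_le s hs c k x).trans ?_
    have h1 : ((2 : ℝ) ^ k)⁻¹ ≤ δ / (1 + l) := by
      rw [← inv_pow, ← one_div]
      exact (pow_le_pow_of_le_one (by norm_num) (by norm_num) hk).trans hK.le
    have h2 : s ≤ 1 + l := by rcases hsl with h | h <;> linarith
    calc s * ((2 : ℝ) ^ k)⁻¹ ≤ (1 + l) * (δ / (1 + l)) := by gcongr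
      _ = δ := by field_simp

/-- Proposition 2.9 of the paper. For any nontrivial `g ∈ G_λ` there
are an open interval `J = (a, b)` with closure contained in `(0,1)` and a nontrivial
element `f` of the normal closure of `g` in `G_λ` whose support is contained in
`⋃_{n ∈ ℤ} (n + J)`. -/
theorem stmt_10 (l : ℝ) (hl : 1 < l) (hirr : Irrational l)
    (g : ↥(Glambda l)) (hg : g ≠ 1) :
    ∃ a b : ℝ, 0 < a ∧ a < b ∧ b < 1 ∧
      ∃ f ∈ Subgroup.normalClosure ({g} : Set ↥(Glambda l)), f ≠ 1 ∧
        {x : ℝ | (f : Equiv.Perm ℝ) x ≠ x} ⊆ ⋃ n : ℤ, Set.Ioo ((n : ℝ) + a) ((n : ℝ) + b) := by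
  have hl0 : 0 < l := by linarith
  obtain ⟨f, hf, hf1, hfε⟩ := exists_mem_normalClosure_abs_sub_le hl0 hirr hg
    (show (0 : ℝ) < 1 / 16 by norm_num)
  -- `f` does not commute with some bump `b` supported on intervals of length at most `1 / 8`
  obtain ⟨k, hk, c, hc⟩ : ∃ k ≥ 3, ∃ c, ¬ Commute (f : Equiv.Perm ℝ) (bump 1 one_pos c k) := by
    by_contra! H
    apply hf1
    ext x
    obtain ⟨n, hn⟩ := exists_int_of_commute_bump one_pos 3 H x
    have hx := hfε x
    rw [hn, mul_one, ← Int.cast_abs] at hx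
    have hn1 : |n| < 1 := by
      have : ((|n| : ℤ) : ℝ) < 1 := by linarith
      exact_mod_cast this
    rw [Int.abs_lt_one_iff.1 hn1] at hn
    simpa [sub_eq_zero] using hn
  let b : Glambda l := ⟨bump 1 one_pos c k, bump_mem_Glambda one_pos (Or.inl rfl) c k⟩
  let t : Glambda l := ⟨Equiv.addRight (1 / 2 - c),
    TbarL_subset_Glambda (Or.inl rfl) (addRight_mem_TbarL one_pos _)⟩
  refine ⟨1 / 4, 3 / 4, by norm_num, by norm_num, by norm_num, t * ⁅f, b⁆ * t⁻¹,
    Subgroup.normalClosure_normal.conj_mem _ (commutator_mem_normalClosure hf b) t, ?_, ?_⟩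
  · rw [Ne, conj_eq_one_iff, commutatorElement_eq_one_iff_commute]
    intro h
    exact hc (h.map (Glambda l).subtype)
  intro x hx
  have hx' : ⁅(f : Equiv.Perm ℝ), bump 1 one_pos c k⁆ (x - (1 / 2 - c)) ≠ x - (1 / 2 - c) := by
    intro h
    apply hx
    change ⁅(f : Equiv.Perm ℝ), bump 1 one_pos c k⁆ (x + -(1 / 2 - c)) + (1 / 2 - c) = x
    rw [← sub_eq_add_neg, h]
    ring
  obtain ⟨z, hz, hzx⟩ : ∃ z, bump 1 one_pos c k z ≠ z ∧ |z - (x - (1 / 2 - c))| ≤ 1 / 16 := by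
    rcases ne_or_ne_of_commutator_ne hx' with h | h
    · exact ⟨_, h, by norm_num⟩
    · exact ⟨_, h, abs_sub_inv_apply_le hfε _⟩
  obtain ⟨h1, h2⟩ := (bump_ne_iff 1 one_pos c k z).1 hz
  have h3 : ((2 : ℝ) ^ k)⁻¹ ≤ 1 / 8 := by
    rw [← inv_pow]
    exact (pow_le_pow_of_le_one (by norm_num) (by norm_num) hk).trans (by norm_num)
  rw [div_one, Int.fract] at h1 h2
  rw [abs_le] at hzx
  rw [mem_iUnion]
  refine ⟨⌊z - c⌋, ?_, ?_⟩ <;> linarith [hzx.1, hzx.2]
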